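/- arXiv:2301.00283 — 4 statements merged into one kernel-verified Lean document; each statement's English description precedes it below -/
import Mathlib

section
/- Let J be the Jacobi matrix of a birth and death chain with reflecting walls on P_{n+1}, and let v_0, ..., v_n ∈ ℝ^{n+1} satisfy J v_ℓ = λ_ℓ v_ℓ with λ_ℓ² ≠ 1 for 1 ≤ ℓ ≤ n−1. Define, for 0 ≤ j ≤ n, p̄_D(j) = (1/2) v_0(j)² v_0(0)² + (1/2) v_n(j)² v_n(0)² + (1/2) Σ_{ℓ=0}^{n} v_ℓ(j)² v_ℓ(0)² + (1/2) Σ_{ℓ=1}^{n−1} (1/(1−λ_ℓ²)) { p^R_{j−1} v_ℓ(j−1)² − λ_ℓ² v_ℓ(j)² + p^L_{j+1} v_ℓ(j+1)² } v_ℓ(0)², with conventions p^R_{−1} = v_ℓ(−1) = p^L_{n+1} = v_ℓ(n+1) = 0. Then for every integer 0 ≤ k ≤ n−1, Σ_{j=0}^{k} p̄_D(j) = Σ_{j=0}^{k} Σ_{ℓ=0}^{n} v_ℓ(j)² v_ℓ(0)² + (1/2) Σ_{ℓ=1}^{n−1} (1/(1−λ_ℓ²)) { − p^R_k v_ℓ(k)²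 + p^L_{k+1} v_ℓ(k+1)² } v_ℓ(0)². -/
open Finset Matrix

/-- The Jacobi matrix of the birth and death chain with reflecting walls on `P_{n+1}`,
with transition probabilities indexed by `ℤ` (so that the conventions at `−1` and `n+1`
can be expressed). -/
noncomputable def bdJacobiZ (n : ℕ) (pL pR : ℤ → ℝ) :
    Matrix (Fin (n + 1)) (Fin (n + 1)) ℝ := fun j k =>
  if (k : ℕ) = (j : ℕ) + 1 then Real.sqrt (pR ((j : ℕ) : ℤ) * pL (((j : ℕ) : ℤ) + 1))
  else if (j : ℕ) = (k : ℕ) + 1 then Real.sqrt (pR ((k : ℕ) : ℤ) * pL (((k : ℕ) : ℤ) + 1))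
  else 0

/-- The time averaged distribution `p̄_D(j)` of Szegedy's walk started from `|0⟩⊗|R⟩`,
expressed via the eigenvalues `λ_ℓ` and eigenvectors `v_ℓ` of the Jacobi matrix,
with the conventions `p^R_{−1} = v_ℓ(−1) = p^L_{n+1} = v_ℓ(n+1) = 0`. -/
noncomputable def pbarD (n : ℕ) (pL pR : ℤ → ℝ) (v : ℕ → ℤ → ℝ) (lam : ℕ → ℝ)
    (j : ℤ) : ℝ :=
  (1 / 2) * v 0 j ^ 2 * v 0 0 ^ 2 + (1 / 2) * v n j ^ 2 * v n 0 ^ 2 +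
    (1 / 2) * ∑ ℓ ∈ Finset.range (n + 1), v ℓ j ^ 2 * v ℓ 0 ^ 2 +
    (1 / 2) * ∑ ℓ ∈ Finset.Icc 1 (n - 1),
      (1 / (1 - lam ℓ ^ 2)) *
        (pR (j - 1) * v ℓ (j - 1) ^ 2 - lam ℓ ^ 2 * v ℓ j ^ 2 +
          pL (j + 1) * v ℓ (j + 1) ^ 2) * v ℓ 0 ^ 2

/-- Splitting off the two extreme terms of a sum over `{0, …, n}`. -/
lemma sum_range_succ_eq_add_sum_Icc_add {M : Type*} [AddCommMonoid M] (f : ℕ → M) {n : ℕ}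
    (hn : 1 ≤ n) :
    ∑ ℓ ∈ Finset.range (n + 1), f ℓ = f 0 + ∑ ℓ ∈ Finset.Icc 1 (n - 1), f ℓ + f n := by
  have h : Finset.range n = insert 0 (Finset.Icc 1 (n - 1)) := by
    ext a
    simp only [Finset.mem_range, Finset.mem_insert, Finset.mem_Icc]
    omega
  rw [Finset.sum_range_succ, h, Finset.sum_insert (by simp)]

/-- The bracket in `pbarD` is, up to a multiple of `1 - λ_ℓ²`, a discrete difference. -/
lemma pbarD_eq_add_sum_sub (n : ℕ) (hn : 1 ≤ n) (pL pR : ℤ → ℝ) (v : ℕ → ℤ → ℝ)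
    (lam : ℕ → ℝ) (hlam : ∀ ℓ, 1 ≤ ℓ → ℓ ≤ n - 1 → lam ℓ ^ 2 ≠ 1) (j : ℤ)
    (hj : pL j + pR j = 1) :
    pbarD n pL pR v lam j =
      (∑ ℓ ∈ Finset.range (n + 1), v ℓ j ^ 2 * v ℓ 0 ^ 2) +
        ((1 / 2) * (∑ ℓ ∈ Finset.Icc 1 (n - 1), (1 / (1 - lam ℓ ^ 2)) *
            (-(pR j * v ℓ j ^ 2) + pL (j + 1) * v ℓ (j + 1) ^ 2) * v ℓ 0 ^ 2) -
          (1 / 2) * ∑ ℓ ∈ Finset.Icc 1 (n - 1), (1 / (1 - lam ℓ ^ 2)) *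
            (-(pR (j - 1) * v ℓ (j - 1) ^ 2) + pL j * v ℓ j ^ 2) * v ℓ 0 ^ 2) := by
  have key : ∑ ℓ ∈ Finset.Icc 1 (n - 1), (1 / (1 - lam ℓ ^ 2)) *
        (pR (j - 1) * v ℓ (j - 1) ^ 2 - lam ℓ ^ 2 * v ℓ j ^ 2 +
          pL (j + 1) * v ℓ (j + 1) ^ 2) * v ℓ 0 ^ 2 =
      ∑ ℓ ∈ Finset.Icc 1 (n - 1), v ℓ j ^ 2 * v ℓ 0 ^ 2 +
        (∑ ℓ ∈ Finset.Icc 1 (n - 1), (1 / (1 - lam ℓ ^ 2)) *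
            (-(pR j * v ℓ j ^ 2) + pL (j + 1) * v ℓ (j + 1) ^ 2) * v ℓ 0 ^ 2 -
          ∑ ℓ ∈ Finset.Icc 1 (n - 1), (1 / (1 - lam ℓ ^ 2)) *
            (-(pR (j - 1) * v ℓ (j - 1) ^ 2) + pL j * v ℓ j ^ 2) * v ℓ 0 ^ 2) := by
    rw [← Finset.sum_sub_distrib, ← Finset.sum_add_distrib]
    refine Finset.sum_congr rfl fun ℓ hℓ => ?_
    rw [Finset.mem_Icc] at hℓ
    have h : 1 - lam ℓ ^ 2 ≠ 0 := sub_ne_zero.mpr (hlam ℓ hℓ.1 hℓ.2).symm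
    rw [eq_sub_of_add_eq hj]
    field_simp
    ring
  rw [pbarD, key, sum_range_succ_eq_add_sum_Icc_add _ hn]
  ring

/-- Partial sums of the time averaged distribution of Szegedy's walk: for every
`0 ≤ k ≤ n−1`,
`∑_{j=0}^{k} p̄_D(j) = ∑_{j=0}^{k} ∑_{ℓ=0}^{n} v_ℓ(j)² v_ℓ(0)²
  + (1/2) ∑_{ℓ=1}^{n−1} (1/(1−λ_ℓ²)) {−p^R_k v_ℓ(k)² + p^L_{k+1} v_ℓ(k+1)²} v_ℓ(0)²`. -/
theorem szegedy_partial_sums (n : ℕ) (hn : 2 ≤ n) (pL pR : ℤ → ℝ)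
    (hsum : ∀ j : ℤ, 0 ≤ j → j ≤ n → pL j + pR j = 1)
    (hL : ∀ j : ℤ, 1 ≤ j → j ≤ (n : ℤ) - 1 → 0 < pL j ∧ pL j < 1)
    (hR0 : pR 0 = 1) (hLn : pL n = 1)
    (hRconv : pR (-1) = 0) (hLconv : pL ((n : ℤ) + 1) = 0)
    (v : ℕ → ℤ → ℝ) (lam : ℕ → ℝ)
    (heig : ∀ ℓ, ℓ ≤ n →
      (bdJacobiZ n pL pR).mulVec (fun j : Fin (n + 1) => v ℓ ((j : ℕ) : ℤ)) =
        lam ℓ • fun j : Fin (n + 1) => v ℓ ((j : ℕ) : ℤ))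
    (hvm : ∀ ℓ, ℓ ≤ n → v ℓ (-1) = 0)
    (hvn : ∀ ℓ, ℓ ≤ n → v ℓ ((n : ℤ) + 1) = 0)
    (hlam : ∀ ℓ, 1 ≤ ℓ → ℓ ≤ n - 1 → lam ℓ ^ 2 ≠ 1) :
    ∀ k : ℕ, k ≤ n - 1 →
      ∑ j ∈ Finset.range (k + 1), pbarD n pL pR v lam (j : ℤ) =
        (∑ j ∈ Finset.range (k + 1), ∑ ℓ ∈ Finset.range (n + 1),
          v ℓ (j : ℤ) ^ 2 * v ℓ 0 ^ 2) +
        (1 / 2) * ∑ ℓ ∈ Finset.Icc 1 (n - 1),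
          (1 / (1 - lam ℓ ^ 2)) *
            (-(pR (k : ℤ) * v ℓ (k : ℤ) ^ 2) + pL ((k : ℤ) + 1) * v ℓ ((k : ℤ) + 1) ^ 2) *
            v ℓ 0 ^ 2 := by
  intro k hk
  have hL0 : pL 0 = 0 := by linarith [hsum 0 le_rfl (by positivity)]
  induction k with
  | zero =>
    rw [zero_add, Finset.sum_range_one, Finset.sum_range_one,
      pbarD_eq_add_sum_sub n (by omega) pL pR v lam hlam _ (hsum _ (by omega) (by omega))]
    simp [hRconv, hL0]
  | succ k ih =>
    rw [Finset.sum_range_succ, ih (by omega), Finset.sum_range_succ _ (k + 1),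
      pbarD_eq_add_sum_sub n (by omega) pL pR v lam hlam _ (hsum _ (by omega) (by omega))]
    simp only [Nat.cast_add, Nat.cast_one, add_sub_cancel_right]
    ring
end

section
/- For each n ≥ 2, let v_0^{(n)}, ..., v_n^{(n)} be an orthonormal eigenbasis of the Jacobi matrix J_n of a birth and death chain with reflecting walls on P_{n+1}, ordered so that the eigenvalues satisfy 1 = λ_0^{(n)} > λ_1^{(n)} > ··· > λ_n^{(n)} = −1. Let F̄ : ℝ → ℝ be a cumulative distribution function and let x ∈ [0,1] be a point at which F̄ is continuous. Suppose that for every point y at which F̄ is continuous, lim_{n→∞} Σ_{j=0}^{⌊ny⌋} Σ_{ℓ=0}^{n} v_ℓ^{(n)}(j)² v_ℓ^{(n)}(0)² = F̄(y). Then lim_{n→∞} Σ_{ℓ=1}^{n−1} v_ℓ^{(n)}(⌊nx⌋)² v_ℓ^{(n)}(0)² = 0 and lim_{n→∞} Σ_{ℓ=1}^{n−1} v_ℓ^{(n)}(⌊nx⌋+1)² v_ℓ^{(n)}(0)² = 0 (with the convention v_ℓ^{(n)}(n+1) = 0). -/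
open Finset Matrix Filter

/-- If monotone-in-`y` distribution functions converge at the continuity points of `F`, then any
nonnegative sequence dominated by all increments around a continuity point vanishes. -/
theorem tendsto_zero_of_le_increments {F : ℝ → ℝ} (hF : Monotone F) {x : ℝ}
    (hx : ContinuousAt F x) {G : ℕ → ℝ → ℝ}
    (hG : ∀ y, ContinuousAt F y → Tendsto (fun n => G n y) atTop (nhds (F y)))
    {f : ℕ → ℝ} (hf : ∀ n, 0 ≤ f n)
    (hle : ∀ a b, a < x → x < b → ∀ᶠ n in atTop, f n ≤ G n b - G n a) :
    Tendsto f atTop (nhds 0) := by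
  have hdense : Dense {y | ContinuousAt F y} := by
    simpa [Set.compl_ofPred] using hF.countable_not_continuousAt.dense_compl ℝ
  refine tendsto_order.2 ⟨fun c hc => Eventually.of_forall fun n => hc.trans_le (hf n),
    fun ε hε => ?_⟩
  obtain ⟨δ, hδ, hδF⟩ := Metric.continuousAt_iff.1 hx (ε / 2) (half_pos hε)
  obtain ⟨a, haF, hxa, hax⟩ := hdense.exists_between (sub_lt_self x hδ)
  obtain ⟨b, hbF, hxb, hbx⟩ := hdense.exists_between (lt_add_of_pos_right x hδ)
  have ha := hδF (x := a) (by rw [Real.dist_eq, abs_lt]; constructor <;> linarith)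
  have hb := hδF (x := b) (by rw [Real.dist_eq, abs_lt]; constructor <;> linarith)
  rw [Real.dist_eq, abs_lt] at ha hb
  have hlt : F b - F a < ε := by linarith
  filter_upwards [((hG b hbF).sub (hG a haF)).eventually_lt_const hlt, hle a b hax hxb]
    with n hn hfn
  exact hfn.trans_lt hn

/-- A point mass in `(a, b]` is at most the increment of the distribution function. -/
theorem le_sum_filter_le_sub_sum_filter_le {s : Finset ℤ} {q : ℤ → ℝ} (hq : ∀ j, 0 ≤ q j)
    {k : ℤ} {a b : ℝ} (hk : k ∈ s) (hak : a < k) (hkb : k ≤ b) :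
    q k ≤ ∑ j ∈ s.filter (fun j : ℤ => (j : ℝ) ≤ b), q j
      - ∑ j ∈ s.filter (fun j : ℤ => (j : ℝ) ≤ a), q j := by
  have hnot : k ∉ s.filter (fun j : ℤ => (j : ℝ) ≤ a) := by simp [hak]
  have hsub : insert k (s.filter (fun j : ℤ => (j : ℝ) ≤ a)) ⊆
      s.filter (fun j : ℤ => (j : ℝ) ≤ b) := by
    intro j hj
    rcases mem_insert.1 hj with rfl | hj
    · exact mem_filter.2 ⟨hk, hkb⟩
    · obtain ⟨hjs, hja⟩ := mem_filter.1 hj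
      exact mem_filter.2 ⟨hjs, by linarith⟩
  have := sum_le_sum_of_subset_of_nonneg hsub (f := q) fun j _ _ => hq j
  rw [sum_insert hnot] at this
  linarith

/-- If rescaled discrete distribution functions converge at the continuity points of `F`, then
the masses at sites within distance one of `n * x` vanish at each continuity point `x`. -/
theorem tendsto_single_site_zero {F : ℝ → ℝ} (hF : Monotone F) {x : ℝ}
    (hx : ContinuousAt F x) {q : ℕ → ℤ → ℝ} (hq : ∀ n j, 0 ≤ q n j)
    (hG : ∀ y : ℝ, ContinuousAt F y →
      Tendsto (fun n : ℕ =>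
        ∑ j ∈ (Finset.Icc (0 : ℤ) (n : ℤ)).filter (fun j : ℤ => (j : ℝ) ≤ (n : ℝ) * y), q n j)
        atTop (nhds (F y)))
    {k : ℕ → ℤ} (hk : ∀ n : ℕ, |(k n : ℝ) - n * x| ≤ 1)
    (hmem : ∀ᶠ n : ℕ in atTop, k n ∈ Finset.Icc (0 : ℤ) (n : ℤ) ∨ q n (k n) = 0) :
    Tendsto (fun n => q n (k n)) atTop (nhds 0) := by
  refine tendsto_zero_of_le_increments hF hx hG (fun n => hq n _) fun a b ha hb => ?_
  have hlarge : ∀ c : ℝ, 0 < c → ∀ᶠ n : ℕ in atTop, 1 < (n : ℝ) * c := fun c hc =>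
    (tendsto_natCast_atTop_atTop.atTop_mul_const hc).eventually_gt_atTop 1
  filter_upwards [hlarge _ (sub_pos.2 ha), hlarge _ (sub_pos.2 hb), hmem] with n hna hnb hn
  have hkn := abs_le.1 (hk n)
  rcases hn with hn | hn
  · exact le_sum_filter_le_sub_sum_filter_le (hq n) hn (by linarith) (by linarith)
  · rw [hn, sub_nonneg]
    have hab : (n : ℝ) * a ≤ n * b := by gcongr; linarith
    exact sum_le_sum_of_subset_of_nonneg
      (monotone_filter_right _ fun j _ hj => le_trans hj hab) fun j _ _ => hq n j

/-- If for every continuity point `y` of a cumulative distribution function `F̄` the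
distribution functions `F̄_n^C(⌊ny⌋) = ∑_{j=0}^{⌊ny⌋} ∑_{ℓ=0}^{n} v_ℓ^{(n)}(j)² v_ℓ^{(n)}(0)²`
of the time averaged CTQW distributions converge to `F̄(y)`, then for every `x ∈ [0,1]` at
which `F̄` is continuous,
`∑_{ℓ=1}^{n−1} v_ℓ^{(n)}(⌊nx⌋)² v_ℓ^{(n)}(0)² → 0` and
`∑_{ℓ=1}^{n−1} v_ℓ^{(n)}(⌊nx⌋+1)² v_ℓ^{(n)}(0)² → 0`
(with the convention `v_ℓ^{(n)}(n+1) = 0`). -/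
theorem ctqw_single_site_vanishing
    (pL pR : ℕ → ℤ → ℝ) (v : ℕ → ℕ → ℤ → ℝ) (lam : ℕ → ℕ → ℝ)
    (hsum : ∀ n : ℕ, 2 ≤ n → ∀ j : ℤ, 0 ≤ j → j ≤ n → pL n j + pR n j = 1)
    (hL : ∀ n : ℕ, 2 ≤ n → ∀ j : ℤ, 1 ≤ j → j ≤ (n : ℤ) - 1 → 0 < pL n j ∧ pL n j < 1)
    (hR0 : ∀ n : ℕ, 2 ≤ n → pR n 0 = 1) (hLn : ∀ n : ℕ, 2 ≤ n → pL n n = 1)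
    (horth : ∀ n : ℕ, 2 ≤ n → ∀ ℓ, ℓ ≤ n → ∀ m, m ≤ n →
      (fun j : Fin (n + 1) => v n ℓ ((j : ℕ) : ℤ)) ⬝ᵥ
          (fun j : Fin (n + 1) => v n m ((j : ℕ) : ℤ)) =
        if ℓ = m then 1 else 0)
    (heig : ∀ n : ℕ, 2 ≤ n → ∀ ℓ, ℓ ≤ n →
      (bdJacobiZ n (pL n) (pR n)).mulVec (fun j : Fin (n + 1) => v n ℓ ((j : ℕ) : ℤ)) =
        lam n ℓ • fun j : Fin (n + 1) => v n ℓ ((j : ℕ) : ℤ))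
    (hlam0 : ∀ n : ℕ, 2 ≤ n → lam n 0 = 1)
    (hlamn : ∀ n : ℕ, 2 ≤ n → lam n n = -1)
    (hdec : ∀ n : ℕ, 2 ≤ n → ∀ ℓ, ℓ < n → lam n (ℓ + 1) < lam n ℓ)
    (hvconv : ∀ n : ℕ, 2 ≤ n → ∀ ℓ, ℓ ≤ n → v n ℓ ((n : ℤ) + 1) = 0)
    (F : ℝ → ℝ) (hFmono : Monotone F)
    (hFright : ∀ y : ℝ, ContinuousWithinAt F (Set.Ici y) y)
    (hFbot : Tendsto F atBot (nhds 0)) (hFtop : Tendsto F atTop (nhds 1))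
    (x : ℝ) (hx0 : 0 ≤ x) (hx1 : x ≤ 1) (hxcont : ContinuousAt F x)
    (hC : ∀ y : ℝ, ContinuousAt F y →
      Tendsto
        (fun n : ℕ =>
          ∑ j ∈ (Finset.Icc (0 : ℤ) (n : ℤ)).filter (fun j : ℤ => (j : ℝ) ≤ (n : ℝ) * y),
            ∑ ℓ ∈ Finset.range (n + 1), v n ℓ j ^ 2 * v n ℓ 0 ^ 2)
        atTop (nhds (F y))) :
    Tendsto
      (fun n : ℕ =>
        ∑ ℓ ∈ Finset.Icc 1 (n - 1), v n ℓ ⌊(n : ℝ) * x⌋ ^ 2 * v n ℓ 0 ^ 2)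
      atTop (nhds 0) ∧
    Tendsto
      (fun n : ℕ =>
        ∑ ℓ ∈ Finset.Icc 1 (n - 1), v n ℓ (⌊(n : ℝ) * x⌋ + 1) ^ 2 * v n ℓ 0 ^ 2)
      atTop (nhds 0) := by
  have hq : ∀ (n : ℕ) (j : ℤ), 0 ≤ ∑ ℓ ∈ Finset.range (n + 1), v n ℓ j ^ 2 * v n ℓ 0 ^ 2 :=
    fun n j => sum_nonneg fun ℓ _ => by positivity
  have hinterior : ∀ k : ℕ → ℤ,
      Tendsto (fun n => ∑ ℓ ∈ Finset.range (n + 1), v n ℓ (k n) ^ 2 * v n ℓ 0 ^ 2)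
        atTop (nhds 0) →
      Tendsto (fun n => ∑ ℓ ∈ Finset.Icc 1 (n - 1), v n ℓ (k n) ^ 2 * v n ℓ 0 ^ 2)
        atTop (nhds 0) := fun k hk =>
    squeeze_zero (fun n => sum_nonneg fun ℓ _ => by positivity)
      (fun n => sum_le_sum_of_subset_of_nonneg
        (fun ℓ hℓ => by rw [Finset.mem_Icc] at hℓ; rw [Finset.mem_range]; omega)
        fun ℓ _ _ => by positivity) hk
  have hfloor_nonneg : ∀ n : ℕ, 0 ≤ ⌊(n : ℝ) * x⌋ := fun n => Int.floor_nonneg.2 (by positivity)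
  have hfloor_le : ∀ n : ℕ, ⌊(n : ℝ) * x⌋ ≤ n := fun n => by
    have h : (⌊(n : ℝ) * x⌋ : ℝ) ≤ n :=
      (Int.floor_le _).trans (mul_le_of_le_one_right n.cast_nonneg hx1)
    exact_mod_cast h
  refine ⟨hinterior _ (tendsto_single_site_zero hFmono hxcont hq hC (fun n => ?_) ?_),
    hinterior _ (tendsto_single_site_zero hFmono hxcont hq hC (fun n => ?_) ?_)⟩
  · have h₁ := Int.floor_le ((n : ℝ) * x)
    have h₂ := Int.lt_floor_add_one ((n : ℝ) * x)
    rw [abs_le]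
    constructor <;> linarith
  · exact Eventually.of_forall fun n =>
      Or.inl (Finset.mem_Icc.2 ⟨hfloor_nonneg n, hfloor_le n⟩)
  · have h₁ := Int.floor_le ((n : ℝ) * x)
    have h₂ := Int.lt_floor_add_one ((n : ℝ) * x)
    rw [abs_le]
    push_cast
    constructor <;> linarith
  · filter_upwards [eventually_ge_atTop 2] with n hn
    rcases (hfloor_le n).eq_or_lt with h | h
    · refine Or.inr (sum_eq_zero fun ℓ hℓ => ?_)
      rw [h, hvconv n hn ℓ (Nat.lt_succ_iff.1 (Finset.mem_range.1 hℓ))]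
      ring
    · exact Or.inl (Finset.mem_Icc.2 ⟨by linarith [hfloor_nonneg n], h⟩)
end

section
/- (Main theorem, spectral form) For each n ≥ 2, let v_0^{(n)}, ..., v_n^{(n)} be an orthonormal eigenbasis of the Jacobi matrix J_n of a birth and death chain with reflecting walls on P_{n+1}, with eigenvalues 1 = λ_0^{(n)} > λ_1^{(n)} > ··· > λ_n^{(n)} = −1. Define F̄_n^C(k) = Σ_{j=0}^{k} Σ_{ℓ=0}^{n} v_ℓ^{(n)}(j)² v_ℓ^{(n)}(0)² and F̄_n^D(k) = F̄_n^C(k) + (1/2) Σ_{ℓ=1}^{n−1} (1/(1−(λ_ℓ^{(n)})²)) { − p^{R,(n)}_k v_ℓ^{(n)}(k)² + p^{L,(n)}_{k+1} v_ℓ^{(n)}(k+1)² } v_ℓ^{(n)}(0)² for integers 0 ≤ k ≤ n−1. Assume the spectral gap condition limsup_{n→∞} λ_1^{(n)} < 1, and let F̄ : ℝ → ℝ be a cumulative distribution function such that lim_{n→∞} F̄_n^C(⌊nx⌋) = F̄(x) for every x at which F̄ is continuous. Then lim_{n→∞} F̄_n^D(⌊nx⌋) = F̄(x) for every x ∈ [0,1]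 at which F̄ is continuous. -/
open Finset Matrix Filter

/-- The distribution function `F̄_n^C(⌊ny⌋) = ∑_{j=0}^{⌊ny⌋} ∑_{ℓ=0}^{n} v_ℓ^{(n)}(j)² v_ℓ^{(n)}(0)²`
of the time averaged distribution of the continuous time quantum walk (the walk lives on
the vertices `0,…,n`). -/
noncomputable def FnC (v : ℕ → ℕ → ℤ → ℝ) (n : ℕ) (y : ℝ) : ℝ :=
  ∑ j ∈ (Finset.Icc (0 : ℤ) (n : ℤ)).filter (fun j : ℤ => (j : ℝ) ≤ (n : ℝ) * y),
    ∑ ℓ ∈ Finset.range (n + 1), v n ℓ j ^ 2 * v n ℓ 0 ^ 2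

/-- A real symmetric matrix which changes sign under conjugation by the diagonal sign matrix `s`
has a spectrum symmetric about `0`; here the spectrum is given by an orthonormal eigenbasis,
the rows of `V`. -/
lemma exists_eigenvalue_eq_neg {ι : Type*} [Fintype ι] [DecidableEq ι]
    {A V : Matrix ι ι ℝ} {s lam : ι → ℝ} (hA : Aᵀ = A) (hs : ∀ i, s i * s i = 1)
    (hsA : ∀ i j, A i j * s j = -(s i * A i j)) (hV : V * Vᵀ = 1)
    (heig : ∀ i, A *ᵥ V i = lam i • V i) (l : ι) : ∃ m, lam m = -lam l := by
  have hV' : Vᵀ * V = 1 := mul_eq_one_comm.mp hV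
  set w : ι → ℝ := fun j => s j * V l j with hw
  have hAw : A *ᵥ w = (-lam l) • w := by
    ext i
    have h := congrFun (heig l) i
    simp only [mulVec, dotProduct, Pi.smul_apply, smul_eq_mul, hw] at h ⊢
    calc ∑ j, A i j * (s j * V l j) = ∑ j, -s i * (A i j * V l j) :=
          Finset.sum_congr rfl fun j _ => by rw [← mul_assoc, hsA]; ring
      _ = -lam l * (s i * V l i) := by rw [← Finset.mul_sum, h]; ring
  have hne : V *ᵥ w ≠ 0 := by
    intro h0
    have hw0 : w = 0 := by
      rw [← one_mulVec w, ← hV', ← mulVec_mulVec, h0, mulVec_zero]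
    have hl : V l = 0 := by
      ext j
      have hj := congrFun hw0 j
      simp only [hw, Pi.zero_apply] at hj
      calc V l j = s j * s j * V l j := by rw [hs, one_mul]
        _ = 0 := by rw [mul_assoc, hj, mul_zero]
    have h1 := congrFun (congrFun hV l) l
    simp [Matrix.mul_apply, hl] at h1
  obtain ⟨m, hm⟩ := Function.ne_iff.mp hne
  refine ⟨m, mul_right_cancel₀ (b := V m ⬝ᵥ w) hm ?_⟩
  have h1 : (A *ᵥ V m) ⬝ᵥ w = V m ⬝ᵥ (A *ᵥ w) := by
    rw [dotProduct_mulVec, ← mulVec_transpose, hA]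
  rw [heig, hAw, smul_dotProduct, dotProduct_smul] at h1
  simpa using h1

lemma bdJacobiZ_transpose (n : ℕ) (pL pR : ℤ → ℝ) :
    (bdJacobiZ n pL pR)ᵀ = bdJacobiZ n pL pR := by
  ext j k
  simp only [transpose_apply, bdJacobiZ]
  split_ifs <;> first | rfl | omega

lemma bdJacobiZ_mul_sign (n : ℕ) (pL pR : ℤ → ℝ) (j k : Fin (n + 1)) :
    bdJacobiZ n pL pR j k * (-1) ^ (k : ℕ) = -((-1) ^ (j : ℕ) * bdJacobiZ n pL pR j k) := by
  simp only [bdJacobiZ]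
  split_ifs with h1 h2
  · rw [h1, pow_succ]; ring
  · rw [h2, pow_succ]; ring
  · simp

/-- The nontrivial eigenvalues of a Jacobi matrix with zero diagonal, listed in decreasing order
with extreme eigenvalues `±1`, are bounded in absolute value by the second largest one. -/
lemma abs_eigenvalue_bdJacobiZ_le {n : ℕ} {pL pR : ℤ → ℝ} {v : ℕ → ℤ → ℝ} {lam : ℕ → ℝ}
    (horth : ∀ ℓ, ℓ ≤ n → ∀ m, m ≤ n →
      (fun j : Fin (n + 1) => v ℓ ((j : ℕ) : ℤ)) ⬝ᵥ (fun j : Fin (n + 1) => v m ((j : ℕ) : ℤ)) =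
        if ℓ = m then 1 else 0)
    (heig : ∀ ℓ, ℓ ≤ n →
      (bdJacobiZ n pL pR).mulVec (fun j : Fin (n + 1) => v ℓ ((j : ℕ) : ℤ)) =
        lam ℓ • fun j : Fin (n + 1) => v ℓ ((j : ℕ) : ℤ))
    (hlam0 : lam 0 = 1) (hlamn : lam n = -1) (hdec : ∀ ℓ, ℓ < n → lam (ℓ + 1) < lam ℓ)
    {ℓ : ℕ} (h1 : 1 ≤ ℓ) (hn : ℓ < n) : |lam ℓ| ≤ lam 1 := by
  have hanti : StrictAntiOn lam (Set.Iic n) :=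
    strictAntiOn_of_succ_lt Set.ordConnected_Iic fun a _ _ ha =>
      hdec a (Nat.lt_of_succ_le ha)
  have hle : ∀ m, 1 ≤ m → m ≤ n → lam m ≤ lam 1 := fun m hm hmn =>
    hanti.antitoneOn (Set.mem_Iic.mpr (hm.trans hmn)) (Set.mem_Iic.mpr hmn) hm
  obtain ⟨m, hm⟩ := exists_eigenvalue_eq_neg (A := bdJacobiZ n pL pR)
    (V := fun l j : Fin (n + 1) => v l ((j : ℕ) : ℤ)) (s := fun j => (-1) ^ (j : ℕ))
    (lam := fun l => lam l) (bdJacobiZ_transpose n pL pR)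
    (fun i => by rw [← mul_pow]; simp) (bdJacobiZ_mul_sign n pL pR)
    (by
      ext l m
      have h := horth l (by omega) m (by omega)
      simp only [Matrix.one_apply, Fin.ext_iff]
      exact h)
    (fun l => heig l (by omega)) ⟨ℓ, by omega⟩
  have hm' : lam m = -lam ℓ := hm
  have hm1 : 1 ≤ (m : ℕ) := by
    by_contra! h
    have h0 : (m : ℕ) = 0 := by omega
    have := hanti (Set.mem_Iic.mpr hn.le) (Set.mem_Iic.mpr le_rfl) hn
    rw [h0, hlam0] at hm'
    linarith
  exact abs_le.mpr ⟨by linarith [hle m hm1 (by omega)], hle ℓ h1 hn.le⟩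

/-- The time averaged distribution of the continuous time walk. -/
noncomputable def timeAvgC (v : ℕ → ℕ → ℤ → ℝ) (n : ℕ) (j : ℤ) : ℝ :=
  ∑ ℓ ∈ Finset.range (n + 1), v n ℓ j ^ 2 * v n ℓ 0 ^ 2

lemma timeAvgC_nonneg (v : ℕ → ℕ → ℤ → ℝ) (n : ℕ) (j : ℤ) : 0 ≤ timeAvgC v n j :=
  Finset.sum_nonneg fun _ _ => by positivity

lemma timeAvgC_le_FnC_sub (v : ℕ → ℕ → ℤ → ℝ) {n : ℕ} {y z : ℝ} {j : ℤ} (hj0 : 0 ≤ j)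
    (hjn : j ≤ n) (hy : (n : ℝ) * y < j) (hz : (j : ℝ) ≤ n * z) :
    timeAvgC v n j ≤ FnC v n z - FnC v n y := by
  have hnot : j ∉ (Finset.Icc (0 : ℤ) (n : ℤ)).filter (fun j : ℤ => (j : ℝ) ≤ (n : ℝ) * y) := by
    simp [hy]
  rw [le_sub_iff_add_le]
  change timeAvgC v n j + ∑ i ∈ _, timeAvgC v n i ≤ ∑ i ∈ _, timeAvgC v n i
  rw [← Finset.sum_insert hnot]
  refine Finset.sum_le_sum_of_subset_of_nonneg (fun i hi => ?_) fun i _ _ => timeAvgC_nonneg v n i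
  rcases Finset.mem_insert.mp hi with rfl | hi
  · simp [hj0, hjn, hz]
  · obtain ⟨hi, hiy⟩ := Finset.mem_filter.mp hi
    exact Finset.mem_filter.mpr ⟨hi, by linarith⟩

lemma tendsto_zero_of_forall_sub_le {a : ℕ → ℝ} {G : ℕ → ℝ → ℝ} {F : ℝ → ℝ} {x : ℝ}
    (hF : Monotone F) (ha : ∀ n, 0 ≤ a n) (hx : ContinuousAt F x)
    (hG : ∀ y, ContinuousAt F y → Tendsto (fun n => G n y) atTop (nhds (F y)))
    (hle : ∀ y z, y < x → x < z → ∀ᶠ n in atTop, a n ≤ G n z - G n y) :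
    Tendsto a atTop (nhds 0) := by
  have hdense : Dense {y | ContinuousAt F y} := by
    have h := hF.countable_not_continuousAt.dense_compl ℝ
    simpa [Set.compl_ofPred] using h
  refine tendsto_order.mpr ⟨fun b hb => .of_forall fun n => hb.trans_le (ha n), fun ε hε => ?_⟩
  obtain ⟨δ, hδ, hball⟩ := Metric.continuousAt_iff.mp hx (ε / 2) (half_pos hε)
  obtain ⟨y, hyc, hy1, hy2⟩ := hdense.exists_between (show x - δ < x by linarith)
  obtain ⟨z, hzc, hz1, hz2⟩ := hdense.exists_between (show x < x + δ by linarith)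
  have hFy := hball (x := y) (by rw [Real.dist_eq, abs_lt]; constructor <;> linarith)
  have hFz := hball (x := z) (by rw [Real.dist_eq, abs_lt]; constructor <;> linarith)
  rw [Real.dist_eq, abs_lt] at hFy hFz
  have hlt : F z - F y < ε := by linarith [hFy.1, hFz.2]
  filter_upwards [hle y z hy2 hz1, ((hG z hzc).sub (hG y hyc)).eventually_lt_const hlt]
    with n h1 h2 using h1.trans_lt h2

lemma floor_natCast_mul_le (n : ℕ) {x : ℝ} (hx : x ≤ 1) : ⌊(n : ℝ) * x⌋ ≤ n := by
  have h : (n : ℝ) * x ≤ n := mul_le_of_le_one_right (by positivity) hx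
  exact_mod_cast (Int.floor_le _).trans h

/-- At a continuity point of the limit, the mass carried by the vertices `⌊nx⌋` and `⌊nx⌋ + 1`
vanishes in the limit. -/
lemma tendsto_timeAvgC_floor_add {v : ℕ → ℕ → ℤ → ℝ} {F : ℝ → ℝ} {x : ℝ} (hF : Monotone F)
    (hvconv : ∀ n : ℕ, 2 ≤ n → ∀ ℓ, ℓ ≤ n → v n ℓ ((n : ℤ) + 1) = 0)
    (hC : ∀ y : ℝ, ContinuousAt F y → Tendsto (fun n : ℕ => FnC v n y) atTop (nhds (F y)))
    (hx0 : 0 ≤ x) (hx1 : x ≤ 1) (hx : ContinuousAt F x) {i : ℤ} (hi0 : 0 ≤ i) (hi1 : i ≤ 1) :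
    Tendsto (fun n : ℕ => timeAvgC v n (⌊(n : ℝ) * x⌋ + i)) atTop (nhds 0) := by
  refine tendsto_zero_of_forall_sub_le hF (fun n => timeAvgC_nonneg v n _) hx hC
    fun y z hy hz => ?_
  have hbig : ∀ c : ℝ, 0 < c → ∀ᶠ n : ℕ in atTop, 1 < (n : ℝ) * c := fun c hc =>
    (tendsto_natCast_atTop_atTop.atTop_mul_const hc).eventually_gt_atTop 1
  filter_upwards [hbig _ (sub_pos.mpr hy), hbig _ (sub_pos.mpr hz), eventually_ge_atTop 2]
    with n hny hnz hn
  have hfl := Int.floor_le ((n : ℝ) * x)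
  have hfl' := Int.lt_floor_add_one ((n : ℝ) * x)
  have hi0' : (0 : ℝ) ≤ i := by exact_mod_cast hi0
  have hi1' : (i : ℝ) ≤ 1 := by exact_mod_cast hi1
  have hk0 : 0 ≤ ⌊(n : ℝ) * x⌋ := Int.floor_nonneg.mpr (by positivity)
  have hkn := floor_natCast_mul_le n hx1
  rcases le_or_gt (⌊(n : ℝ) * x⌋ + i) n with h | h
  · exact timeAvgC_le_FnC_sub v (by omega) h (by push_cast; nlinarith) (by push_cast; nlinarith)
  · have hk : ⌊(n : ℝ) * x⌋ + i = n + 1 := by omega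
    have h0 : timeAvgC v n (⌊(n : ℝ) * x⌋ + i) = 0 := by
      rw [hk]
      exact Finset.sum_eq_zero fun ℓ hℓ => by
        rw [hvconv n hn ℓ (Nat.lt_succ_iff.mp (Finset.mem_range.mp hℓ))]; simp
    rw [h0, sub_nonneg]
    have hyz : (n : ℝ) * y ≤ n * z := mul_le_mul_of_nonneg_left (by linarith) (by positivity)
    refine Finset.sum_le_sum_of_subset_of_nonneg (fun i hi => ?_)
      fun i _ _ => timeAvgC_nonneg v n i
    obtain ⟨hi, hiy⟩ := Finset.mem_filter.mp hi
    exact Finset.mem_filter.mpr ⟨hi, hiy.trans hyz⟩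

lemma abs_sum_correction_le {v : ℕ → ℕ → ℤ → ℝ} {lam : ℕ → ℝ} {n : ℕ} {p q c : ℝ} {k : ℤ}
    (hp0 : 0 ≤ p) (hp1 : p ≤ 1) (hq0 : 0 ≤ q) (hq1 : q ≤ 1) (hc : c < 1)
    (hlam : ∀ ℓ, 1 ≤ ℓ → ℓ < n → |lam ℓ| ≤ c) :
    |∑ ℓ ∈ Finset.Icc 1 (n - 1), (1 / (1 - lam ℓ ^ 2)) *
        (-(p * v n ℓ k ^ 2) + q * v n ℓ (k + 1) ^ 2) * v n ℓ 0 ^ 2| ≤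
      (1 - c)⁻¹ * (timeAvgC v n k + timeAvgC v n (k + 1)) := by
  have hc' : 0 < 1 - c := sub_pos.mpr hc
  calc _ ≤ ∑ ℓ ∈ Finset.Icc 1 (n - 1),
        (1 - c)⁻¹ * (v n ℓ k ^ 2 * v n ℓ 0 ^ 2 + v n ℓ (k + 1) ^ 2 * v n ℓ 0 ^ 2) := by
        refine (Finset.abs_sum_le_sum_abs _ _).trans (Finset.sum_le_sum fun ℓ hℓ => ?_)
        obtain ⟨h1, h2⟩ := Finset.mem_Icc.mp hℓ
        have hl := hlam ℓ h1 (by omega)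
        have hsq : lam ℓ ^ 2 ≤ c := by
          rw [← sq_abs]; nlinarith [abs_nonneg (lam ℓ)]
        have hinv : |1 / (1 - lam ℓ ^ 2)| ≤ (1 - c)⁻¹ := by
          rw [abs_of_nonneg (one_div_nonneg.mpr (by linarith)), one_div]
          exact inv_anti₀ hc' (by linarith)
        have habs : |-(p * v n ℓ k ^ 2) + q * v n ℓ (k + 1) ^ 2| ≤
            v n ℓ k ^ 2 + v n ℓ (k + 1) ^ 2 := by
          have ha := sq_nonneg (v n ℓ k)
          have hb := sq_nonneg (v n ℓ (k + 1))
          rw [abs_le]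
          constructor <;> nlinarith
        rw [abs_mul, abs_mul, abs_of_nonneg (sq_nonneg (v n ℓ 0)), ← add_mul, ← mul_assoc]
        gcongr
    _ ≤ ∑ ℓ ∈ Finset.range (n + 1),
        (1 - c)⁻¹ * (v n ℓ k ^ 2 * v n ℓ 0 ^ 2 + v n ℓ (k + 1) ^ 2 * v n ℓ 0 ^ 2) := by
        refine Finset.sum_le_sum_of_subset_of_nonneg (fun ℓ hℓ => ?_) fun _ _ _ => by positivity
        have := Finset.mem_Icc.mp hℓ
        exact Finset.mem_range.mpr (by omega)
    _ = _ := by rw [← Finset.mul_sum, Finset.sum_add_distrib]; rfl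

lemma transition_bounds {n : ℕ} {pL pR : ℤ → ℝ}
    (hsum : ∀ j : ℤ, 0 ≤ j → j ≤ n → pL j + pR j = 1)
    (hL : ∀ j : ℤ, 1 ≤ j → j ≤ (n : ℤ) - 1 → 0 < pL j ∧ pL j < 1)
    (hR0 : pR 0 = 1) (hLn : pL n = 1) (hLconv : pL ((n : ℤ) + 1) = 0)
    {k : ℤ} (hk0 : 0 ≤ k) (hkn : k ≤ n) :
    (0 ≤ pR k ∧ pR k ≤ 1) ∧ 0 ≤ pL (k + 1) ∧ pL (k + 1) ≤ 1 := by
  have hLb : ∀ j : ℤ, 0 ≤ j → j ≤ (n : ℤ) + 1 → 0 ≤ pL j ∧ pL j ≤ 1 := by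
    intro j hj0 hjn
    rcases hj0.eq_or_lt with rfl | hj0
    · have := hsum 0 le_rfl (by omega)
      constructor <;> linarith
    rcases hjn.eq_or_lt with rfl | hjn
    · simp [hLconv]
    rcases (Int.lt_add_one_iff.mp hjn).eq_or_lt with rfl | hjn
    · simp [hLn]
    · have := hL j (by omega) (by omega)
      exact ⟨this.1.le, this.2.le⟩
  have h1 := hLb k hk0 (by omega)
  have h2 := hsum k hk0 hkn
  exact ⟨⟨by linarith, by linarith⟩, hLb (k + 1) (by omega) (by omega)⟩

/-- Main theorem (spectral form). Assume the spectral gap condition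
`limsup_n λ_1^{(n)} < 1`. If `F̄_n^C(⌊nx⌋) → F̄(x)` at every continuity point `x` of the
cumulative distribution function `F̄`, then also
`F̄_n^D(⌊nx⌋) = F̄_n^C(⌊nx⌋) + (1/2)∑_{ℓ=1}^{n−1} (1/(1−(λ_ℓ^{(n)})²))
  {−p^R_{⌊nx⌋} v_ℓ^{(n)}(⌊nx⌋)² + p^L_{⌊nx⌋+1} v_ℓ^{(n)}(⌊nx⌋+1)²} v_ℓ^{(n)}(0)² → F̄(x)`
for every `x ∈ [0,1]` at which `F̄` is continuous. -/
theorem szegedy_scaling_limit_spectral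
    (pL pR : ℕ → ℤ → ℝ) (v : ℕ → ℕ → ℤ → ℝ) (lam : ℕ → ℕ → ℝ)
    (hsum : ∀ n : ℕ, 2 ≤ n → ∀ j : ℤ, 0 ≤ j → j ≤ n → pL n j + pR n j = 1)
    (hL : ∀ n : ℕ, 2 ≤ n → ∀ j : ℤ, 1 ≤ j → j ≤ (n : ℤ) - 1 → 0 < pL n j ∧ pL n j < 1)
    (hR0 : ∀ n : ℕ, 2 ≤ n → pR n 0 = 1) (hLn : ∀ n : ℕ, 2 ≤ n → pL n n = 1)
    (hLconv : ∀ n : ℕ, 2 ≤ n → pL n ((n : ℤ) + 1) = 0)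
    (horth : ∀ n : ℕ, 2 ≤ n → ∀ ℓ, ℓ ≤ n → ∀ m, m ≤ n →
      (fun j : Fin (n + 1) => v n ℓ ((j : ℕ) : ℤ)) ⬝ᵥ
          (fun j : Fin (n + 1) => v n m ((j : ℕ) : ℤ)) =
        if ℓ = m then 1 else 0)
    (heig : ∀ n : ℕ, 2 ≤ n → ∀ ℓ, ℓ ≤ n →
      (bdJacobiZ n (pL n) (pR n)).mulVec (fun j : Fin (n + 1) => v n ℓ ((j : ℕ) : ℤ)) =
        lam n ℓ • fun j : Fin (n + 1) => v n ℓ ((j : ℕ) : ℤ))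
    (hlam0 : ∀ n : ℕ, 2 ≤ n → lam n 0 = 1)
    (hlamn : ∀ n : ℕ, 2 ≤ n → lam n n = -1)
    (hdec : ∀ n : ℕ, 2 ≤ n → ∀ ℓ, ℓ < n → lam n (ℓ + 1) < lam n ℓ)
    (hvconv : ∀ n : ℕ, 2 ≤ n → ∀ ℓ, ℓ ≤ n → v n ℓ ((n : ℤ) + 1) = 0)
    (hgap : Filter.limsup (fun n : ℕ => lam n 1) atTop < 1)
    (F : ℝ → ℝ) (hFmono : Monotone F)
    (hFright : ∀ y : ℝ, ContinuousWithinAt F (Set.Ici y) y)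
    (hFbot : Tendsto F atBot (nhds 0)) (hFtop : Tendsto F atTop (nhds 1))
    (hC : ∀ y : ℝ, ContinuousAt F y → Tendsto (fun n : ℕ => FnC v n y) atTop (nhds (F y))) :
    ∀ x : ℝ, 0 ≤ x → x ≤ 1 → ContinuousAt F x →
      Tendsto
        (fun n : ℕ =>
          FnC v n x +
            (1 / 2) * ∑ ℓ ∈ Finset.Icc 1 (n - 1),
              (1 / (1 - lam n ℓ ^ 2)) *
                (-(pR n ⌊(n : ℝ) * x⌋ * v n ℓ ⌊(n : ℝ) * x⌋ ^ 2) +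
                  pL n (⌊(n : ℝ) * x⌋ + 1) * v n ℓ (⌊(n : ℝ) * x⌋ + 1) ^ 2) *
                v n ℓ 0 ^ 2)
        atTop (nhds (F x)) := by
  intro x hx0 hx1 hx
  have hlam : ∀ n : ℕ, 2 ≤ n → ∀ ℓ, 1 ≤ ℓ → ℓ < n → |lam n ℓ| ≤ lam n 1 := fun n hn ℓ h1 h2 =>
    abs_eigenvalue_bdJacobiZ_le (horth n hn) (heig n hn) (hlam0 n hn) (hlamn n hn) (hdec n hn)
      h1 h2
  obtain ⟨c, hc, hc1⟩ := exists_between hgap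
  have hbdd : IsBoundedUnder (· ≤ ·) atTop fun n : ℕ => lam n 1 := by
    refine isBoundedUnder_of_eventually_le (a := 1) ?_
    filter_upwards [eventually_ge_atTop 2] with n hn
    have := hdec n hn 0 (by omega)
    rw [hlam0 n hn] at this
    exact this.le
  have hev := eventually_lt_of_limsup_lt hc hbdd
  have hmass : Tendsto (fun n : ℕ => (1 - c)⁻¹ *
      (timeAvgC v n ⌊(n : ℝ) * x⌋ + timeAvgC v n (⌊(n : ℝ) * x⌋ + 1))) atTop (nhds 0) := by
    have h0 := tendsto_timeAvgC_floor_add hFmono hvconv hC hx0 hx1 hx le_rfl zero_le_one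
    have h1 := tendsto_timeAvgC_floor_add hFmono hvconv hC hx0 hx1 hx zero_le_one le_rfl
    simpa using (h0.add h1).const_mul (1 - c)⁻¹
  have hcorr := squeeze_zero_norm' (a := fun n : ℕ => (1 - c)⁻¹ *
      (timeAvgC v n ⌊(n : ℝ) * x⌋ + timeAvgC v n (⌊(n : ℝ) * x⌋ + 1)))
    (f := fun n : ℕ => ∑ ℓ ∈ Finset.Icc 1 (n - 1),
      (1 / (1 - lam n ℓ ^ 2)) *
        (-(pR n ⌊(n : ℝ) * x⌋ * v n ℓ ⌊(n : ℝ) * x⌋ ^ 2) +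
          pL n (⌊(n : ℝ) * x⌋ + 1) * v n ℓ (⌊(n : ℝ) * x⌋ + 1) ^ 2) *
        v n ℓ 0 ^ 2) (by
    filter_upwards [hev, eventually_ge_atTop 2] with n hnc hn
    have hk0 : 0 ≤ ⌊(n : ℝ) * x⌋ := Int.floor_nonneg.mpr (by positivity)
    obtain ⟨⟨hp0, hp1⟩, hq0, hq1⟩ :=
      transition_bounds (hsum n hn) (hL n hn) (hR0 n hn) (hLn n hn) (hLconv n hn) hk0
        (floor_natCast_mul_le n hx1)
    exact abs_sum_correction_le hp0 hp1 hq0 hq1 hc1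
      fun ℓ h1 h2 => (hlam n hn ℓ h1 h2).trans hnc.le) hmass
  simpa using (hC x hx).add (hcorr.const_mul (1 / 2 : ℝ))
end

section
/- Let U = SC be the evolution operator of Szegedy's walk on P_{n+1} associated to a birth and death chain with reflecting walls with Jacobi matrix J. Let v ∈ ℝ^{n+1} satisfy J v = λ v with −1 < λ < 1, and set μ_± = λ ± i√(1−λ²) (so μ_± = exp(±i cos^{−1} λ)). Then the vectors |u_±⟩ = |v̄⟩ − μ_± S|v̄⟩ satisfy U |u_±⟩ = μ_± |u_±⟩, where |v̄⟩ = v(0)|0⟩⊗|R⟩ + Σ_{j=1}^{n−1} v(j)|j⟩⊗|φ_j⟩ + v(n)|n⟩⊗|L⟩. -/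
open Finset Matrix

/-- The Jacobi matrix of the birth and death chain with reflecting walls on `P_{n+1}`. -/
noncomputable def bdJacobi (n : ℕ) (pL pR : ℕ → ℝ) :
    Matrix (Fin (n + 1)) (Fin (n + 1)) ℝ := fun j k =>
  if (k : ℕ) = (j : ℕ) + 1 then Real.sqrt (pR j * pL ((j : ℕ) + 1))
  else if (j : ℕ) = (k : ℕ) + 1 then Real.sqrt (pR k * pL ((k : ℕ) + 1))
  else 0

/-- The local coin state `|φ_j⟩ = √(p^L_j)|L⟩ + √(p^R_j)|R⟩`, with `|L⟩` the coin state
`0` and `|R⟩` the coin state `1`. -/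
noncomputable def phiCoin (pL pR : ℕ → ℝ) (j : ℕ) : Fin 2 → ℝ := fun b =>
  if b = 0 then Real.sqrt (pL j) else Real.sqrt (pR j)

/-- The coin operator `C = |0⟩⟨0|⊗I₂ + ∑_{j=1}^{n−1}|j⟩⟨j|⊗(2|φ_j⟩⟨φ_j| − I₂) + |n⟩⟨n|⊗I₂`
of Szegedy's walk on `P_{n+1}`. -/
noncomputable def szegedyCoin (n : ℕ) (pL pR : ℕ → ℝ) :
    Matrix (Fin (n + 1) × Fin 2) (Fin (n + 1) × Fin 2) ℂ := fun q r =>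
  if q.1 = r.1 then
    (if (q.1 : ℕ) = 0 ∨ (q.1 : ℕ) = n then (if q.2 = r.2 then 1 else 0)
     else (((2 * phiCoin pL pR (q.1 : ℕ) q.2 * phiCoin pL pR (r.1 : ℕ) r.2 -
         if q.2 = r.2 then 1 else 0 : ℝ)) : ℂ))
  else 0

/-- The flip-flop shift operator `S` of Szegedy's walk, determined by
`S(|j⟩⊗|L⟩) = |j−1⟩⊗|R⟩` and `S(|j⟩⊗|R⟩) = |j+1⟩⊗|L⟩`. -/
noncomputable def szegedyShift (n : ℕ) :
    Matrix (Fin (n + 1) × Fin 2) (Fin (n + 1) × Fin 2) ℂ := fun q r =>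
  if r.2 = 0 ∧ q.2 = 1 ∧ (q.1 : ℕ) + 1 = (r.1 : ℕ) then 1
  else if r.2 = 1 ∧ q.2 = 0 ∧ (r.1 : ℕ) + 1 = (q.1 : ℕ) then 1
  else 0

/-- The lift `|v̄⟩ = v(0)|0⟩⊗|R⟩ + ∑_{j=1}^{n−1} v(j)|j⟩⊗|φ_j⟩ + v(n)|n⟩⊗|L⟩` of a vector
`v ∈ ℝ^{n+1}`. -/
noncomputable def liftVec (n : ℕ) (pL pR : ℕ → ℝ) (v : Fin (n + 1) → ℝ) :
    Fin (n + 1) × Fin 2 → ℂ := fun q =>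
  if (q.1 : ℕ) = 0 then (if q.2 = 1 then (v q.1 : ℂ) else 0)
  else if (q.1 : ℕ) = n then (if q.2 = 0 then (v q.1 : ℂ) else 0)
  else ((v q.1 * phiCoin pL pR (q.1 : ℕ) q.2 : ℝ) : ℂ)

section Szegedy

variable {n : ℕ} {pL pR : ℕ → ℝ}

lemma szegedyShift_mulVec_castSucc_one (w : Fin (n + 1) × Fin 2 → ℂ) (j : Fin n) :
    (szegedyShift n).mulVec w (j.castSucc, 1) = w (j.succ, 0) := by
  rw [Matrix.mulVec, dotProduct, Finset.sum_eq_single (j.succ, 0)]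
  · simp [szegedyShift]
  · rintro ⟨k, b⟩ - hb
    have h : ¬ (b = 0 ∧ (j : ℕ) + 1 = (k : ℕ)) := fun ⟨h1, h2⟩ =>
      hb (Prod.ext (Fin.ext (by simpa using h2.symm)) h1)
    simp [szegedyShift, h]
  · simp

lemma szegedyShift_mulVec_succ_zero (w : Fin (n + 1) × Fin 2 → ℂ) (j : Fin n) :
    (szegedyShift n).mulVec w (j.succ, 0) = w (j.castSucc, 1) := by
  rw [Matrix.mulVec, dotProduct, Finset.sum_eq_single (j.castSucc, 1)]
  · simp [szegedyShift]
  · rintro ⟨k, b⟩ - hb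
    have h : ¬ (b = 1 ∧ (k : ℕ) = (j : ℕ)) := fun ⟨h1, h2⟩ =>
      hb (Prod.ext (Fin.ext (by simpa using h2)) h1)
    simp [szegedyShift, h]
  · simp

lemma szegedyShift_mulVec_zero_zero (w : Fin (n + 1) × Fin 2 → ℂ) :
    (szegedyShift n).mulVec w (0, 0) = 0 := by
  simp [Matrix.mulVec, dotProduct, szegedyShift]

lemma szegedyShift_mulVec_last_one (w : Fin (n + 1) × Fin 2 → ℂ) :
    (szegedyShift n).mulVec w (Fin.last n, 1) = 0 := by
  refine Finset.sum_eq_zero fun ⟨k, b⟩ _ => ?_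
  have h : n + 1 ≠ (k : ℕ) := by have := k.isLt; omega
  simp [szegedyShift, h]

/-- The shift is an involution on the vectors vanishing on the two arcs that leave the path. -/
lemma szegedyShift_mulVec_mulVec {w : Fin (n + 1) × Fin 2 → ℂ} (h0 : w (0, 0) = 0)
    (hn : w (Fin.last n, 1) = 0) :
    (szegedyShift n).mulVec ((szegedyShift n).mulVec w) = w := by
  ext ⟨j, b⟩
  fin_cases b
  · induction j using Fin.cases with
    | zero => exact (szegedyShift_mulVec_zero_zero _).trans h0.symm
    | succ j =>
      exact (szegedyShift_mulVec_succ_zero _ j).trans (szegedyShift_mulVec_castSucc_one w j)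
  · induction j using Fin.lastCases with
    | last => exact (szegedyShift_mulVec_last_one _).trans hn.symm
    | cast j =>
      exact (szegedyShift_mulVec_castSucc_one _ j).trans (szegedyShift_mulVec_succ_zero w j)

lemma szegedyCoin_mulVec_apply (w : Fin (n + 1) × Fin 2 → ℂ) (j : Fin (n + 1)) (b : Fin 2) :
    (szegedyCoin n pL pR).mulVec w (j, b) =
      if (j : ℕ) = 0 ∨ (j : ℕ) = n then w (j, b)
      else 2 * phiCoin pL pR j b *
        (phiCoin pL pR j 0 * w (j, 0) + phiCoin pL pR j 1 * w (j, 1)) - w (j, b) := by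
  rw [Matrix.mulVec, dotProduct, Fintype.sum_prod_type, Finset.sum_eq_single j]
  · split_ifs with h
    · simp only [szegedyCoin, if_pos h, if_true]
      fin_cases b <;> simp
    · simp only [szegedyCoin, if_neg h, if_true]
      fin_cases b <;> simp <;> ring
  · intro k _ hk
    simp [szegedyCoin, hk.symm]
  · simp

lemma phiCoin_reflecting_left (hR0 : pR 0 = 1) (h : pL 0 + pR 0 = 1) (b : Fin 2) :
    phiCoin pL pR 0 b = if b = 1 then 1 else 0 := by
  have : pL 0 = 0 := by linarith
  fin_cases b <;> simp [phiCoin, hR0, this]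

lemma phiCoin_reflecting_right (hLn : pL n = 1) (h : pL n + pR n = 1) (b : Fin 2) :
    phiCoin pL pR n b = if b = 0 then 1 else 0 := by
  have : pR n = 0 := by linarith
  fin_cases b <;> simp [phiCoin, hLn, this]

lemma liftVec_apply (hsum : ∀ j, j ≤ n → pL j + pR j = 1) (hR0 : pR 0 = 1) (hLn : pL n = 1)
    (v : Fin (n + 1) → ℝ) (j : Fin (n + 1)) (b : Fin 2) :
    liftVec n pL pR v (j, b) = v j * phiCoin pL pR j b := by
  unfold liftVec
  dsimp only
  split_ifs with h0 hb hn hb <;>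
    simp [*, phiCoin_reflecting_left hR0 (hsum 0 n.zero_le),
      phiCoin_reflecting_right hLn (hsum n le_rfl)]

/-- The Jacobi matrix as the compression of the shift to the coin states. -/
lemma phiCoin_szegedyShift_liftVec (hsum : ∀ j, j ≤ n → pL j + pR j = 1)
    (hpR : ∀ j, j ≤ n → 0 ≤ pR j) (hR0 : pR 0 = 1) (hLn : pL n = 1)
    (v : Fin (n + 1) → ℝ) (j : Fin (n + 1)) :
    (phiCoin pL pR j 0 : ℂ) * (szegedyShift n).mulVec (liftVec n pL pR v) (j, 0) +
      phiCoin pL pR j 1 * (szegedyShift n).mulVec (liftVec n pL pR v) (j, 1) =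
      ((bdJacobi n pL pR).mulVec v j : ℝ) := by
  simp only [Matrix.mulVec, dotProduct, Fintype.sum_prod_type, Fin.sum_univ_two, Finset.mul_sum,
    ← Finset.sum_add_distrib, Complex.ofReal_sum, liftVec_apply hsum hR0 hLn]
  refine Finset.sum_congr rfl fun k _ => ?_
  have hk := Real.sqrt_mul (hpR k k.is_le)
  have hj := Real.sqrt_mul (hpR j j.is_le)
  by_cases h1 : (k : ℕ) = j + 1
  · have h2 : (j : ℕ) + 1 + 1 ≠ j := by omega
    simp [szegedyShift, bdJacobi, phiCoin, h1, h2, hj]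
    ring
  · by_cases h2 : (j : ℕ) = k + 1
    · have h3 : (k : ℕ) + 1 + 1 ≠ k := by omega
      simp [szegedyShift, bdJacobi, phiCoin, h2, h3, h3.symm, hk]
      ring
    · simp [szegedyShift, bdJacobi, h1, h2, Ne.symm h1, Ne.symm h2]

lemma szegedyCoin_mulVec_liftVec (hsum : ∀ j, j ≤ n → pL j + pR j = 1)
    (hpL : ∀ j, j ≤ n → 0 ≤ pL j) (hpR : ∀ j, j ≤ n → 0 ≤ pR j) (hR0 : pR 0 = 1)
    (hLn : pL n = 1) (v : Fin (n + 1) → ℝ) :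
    (szegedyCoin n pL pR).mulVec (liftVec n pL pR v) = liftVec n pL pR v := by
  ext ⟨j, b⟩
  rw [szegedyCoin_mulVec_apply]
  split_ifs with h
  · rfl
  · have hφ : (phiCoin pL pR j 0 : ℂ) ^ 2 + (phiCoin pL pR j 1 : ℂ) ^ 2 = 1 := by
      norm_cast
      simp [phiCoin, Real.sq_sqrt (hpL j j.is_le), Real.sq_sqrt (hpR j j.is_le), hsum j j.is_le]
    simp only [liftVec_apply hsum hR0 hLn]
    linear_combination 2 * (phiCoin pL pR j b : ℂ) * v j * hφ

lemma szegedyCoin_mulVec_szegedyShift_liftVec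
    (hsum : ∀ j, j ≤ n → pL j + pR j = 1)
    (hpR : ∀ j, j ≤ n → 0 ≤ pR j) (hR0 : pR 0 = 1) (hLn : pL n = 1)
    {lam : ℝ} {v : Fin (n + 1) → ℝ} (heig : (bdJacobi n pL pR).mulVec v = lam • v) :
    (szegedyCoin n pL pR).mulVec ((szegedyShift n).mulVec (liftVec n pL pR v)) =
      (2 * lam : ℂ) • liftVec n pL pR v - (szegedyShift n).mulVec (liftVec n pL pR v) := by
  ext ⟨j, b⟩
  have key := phiCoin_szegedyShift_liftVec hsum hpR hR0 hLn v j
  rw [heig] at key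
  simp only [Pi.smul_apply, smul_eq_mul, Complex.ofReal_mul] at key
  rw [szegedyCoin_mulVec_apply]
  simp only [Pi.sub_apply, Pi.smul_apply, smul_eq_mul, liftVec_apply hsum hR0 hLn]
  split_ifs with h
  · rcases h with h | h
    · obtain rfl : j = 0 := Fin.ext h
      simp only [Fin.val_zero, phiCoin_reflecting_left hR0 (hsum 0 n.zero_le)] at key ⊢
      fin_cases b
      · simp [szegedyShift_mulVec_zero_zero]
      · simp at key ⊢
        linear_combination 2 * key
    · obtain rfl : j = Fin.last n := Fin.ext h
      simp only [Fin.val_last, phiCoin_reflecting_right hLn (hsum n le_rfl)] at key ⊢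
      fin_cases b
      · simp at key ⊢
        linear_combination 2 * key
      · simp [szegedyShift_mulVec_last_one]
  · rw [key]
    ring

/-- Either root `μ` of `μ² - 2λμ + 1` lifts the eigenvalue `λ` of the Jacobi matrix to the
walk. -/
lemma szegedy_mulVec_of_root (hn : n ≠ 0) (hsum : ∀ j, j ≤ n → pL j + pR j = 1)
    (hpL : ∀ j, j ≤ n → 0 ≤ pL j) (hpR : ∀ j, j ≤ n → 0 ≤ pR j) (hR0 : pR 0 = 1)
    (hLn : pL n = 1) {lam : ℝ} {v : Fin (n + 1) → ℝ}
    (heig : (bdJacobi n pL pR).mulVec v = lam • v) {μ : ℂ} (hμ : μ ^ 2 - 2 * lam * μ + 1 = 0) :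
    (szegedyShift n * szegedyCoin n pL pR).mulVec
        (liftVec n pL pR v - μ • (szegedyShift n).mulVec (liftVec n pL pR v)) =
      μ • (liftVec n pL pR v - μ • (szegedyShift n).mulVec (liftVec n pL pR v)) := by
  have hSS : (szegedyShift n).mulVec ((szegedyShift n).mulVec (liftVec n pL pR v)) =
      liftVec n pL pR v :=
    szegedyShift_mulVec_mulVec (by simp [liftVec]) (by simp [liftVec, hn])
  rw [← Matrix.mulVec_mulVec, Matrix.mulVec_sub, Matrix.mulVec_smul,
    szegedyCoin_mulVec_liftVec hsum hpL hpR hR0 hLn,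
    szegedyCoin_mulVec_szegedyShift_liftVec hsum hpR hR0 hLn heig, Matrix.mulVec_sub,
    Matrix.mulVec_smul, Matrix.mulVec_sub, Matrix.mulVec_smul, hSS]
  ext q
  simp only [Pi.sub_apply, Pi.smul_apply, smul_eq_mul]
  linear_combination (szegedyShift n).mulVec (liftVec n pL pR v) q * hμ

end Szegedy

/-- If `J v = λ v` with `−1 < λ < 1` and `μ_± = λ ± i√(1−λ²)`, then the vectors
`|u_±⟩ = |v̄⟩ − μ_± S|v̄⟩` satisfy `U|u_±⟩ = μ_±|u_±⟩` for the evolution operator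
`U = SC` of Szegedy's walk. -/
theorem szegedy_eigenvectors (n : ℕ) (hn : 2 ≤ n) (pL pR : ℕ → ℝ)
    (hsum : ∀ j, j ≤ n → pL j + pR j = 1)
    (hL : ∀ j, 1 ≤ j → j ≤ n - 1 → 0 < pL j ∧ pL j < 1)
    (hR0 : pR 0 = 1) (hLn : pL n = 1)
    (lam : ℝ) (hlam1 : -1 < lam) (hlam2 : lam < 1)
    (v : Fin (n + 1) → ℝ)
    (heig : (bdJacobi n pL pR).mulVec v = lam • v) :
    (szegedyShift n * szegedyCoin n pL pR).mulVec
        (liftVec n pL pR v -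
          ((lam : ℂ) + Complex.I * (Real.sqrt (1 - lam ^ 2) : ℂ)) •
            (szegedyShift n).mulVec (liftVec n pL pR v)) =
      ((lam : ℂ) + Complex.I * (Real.sqrt (1 - lam ^ 2) : ℂ)) •
        (liftVec n pL pR v -
          ((lam : ℂ) + Complex.I * (Real.sqrt (1 - lam ^ 2) : ℂ)) •
            (szegedyShift n).mulVec (liftVec n pL pR v)) ∧
    (szegedyShift n * szegedyCoin n pL pR).mulVec
        (liftVec n pL pR v -
          ((lam : ℂ) - Complex.I * (Real.sqrt (1 - lam ^ 2) : ℂ)) •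
            (szegedyShift n).mulVec (liftVec n pL pR v)) =
      ((lam : ℂ) - Complex.I * (Real.sqrt (1 - lam ^ 2) : ℂ)) •
        (liftVec n pL pR v -
          ((lam : ℂ) - Complex.I * (Real.sqrt (1 - lam ^ 2) : ℂ)) •
            (szegedyShift n).mulVec (liftVec n pL pR v)) := by
  have hp : ∀ j, j ≤ n → 0 ≤ pL j ∧ 0 ≤ pR j := by
    intro j hj
    have hs := hsum j hj
    rcases Nat.eq_zero_or_pos j with rfl | h0
    · constructor <;> linarith
    · rcases hj.eq_or_lt with rfl | h1
      · constructor <;> linarith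
      · have := hL j h0 (by omega)
        constructor <;> linarith
  have hs : (Real.sqrt (1 - lam ^ 2) : ℂ) ^ 2 = 1 - (lam : ℂ) ^ 2 := by
    have := Real.sq_sqrt (show 0 ≤ 1 - lam ^ 2 by nlinarith)
    exact_mod_cast this
  have key := fun (μ : ℂ) => szegedy_mulVec_of_root (μ := μ) (by omega) hsum
    (fun j hj => (hp j hj).1) (fun j hj => (hp j hj).2) hR0 hLn heig
  constructor <;> apply key <;>
    linear_combination (Real.sqrt (1 - lam ^ 2) : ℂ) ^ 2 * Complex.I_sq - hs
end
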